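/- For every i ∈ {1,…,k} it holds that 1 − φ(P_i)/λ_{k+1} ≤ ‖f̂_i‖² = ∑_{j=1}^k (α_j^{(i)})² ≤ 1, and for all distinct p,q ∈ {1,…,k} it holds that |⟨f̂_p, f̂_q⟩| ≤ √(φ(P_p)·φ(P_q))/λ_{k+1}. -/

import Mathlib

open Finset BigOperators Matrix

namespace SpectralClustering

variable {V : Type} [Fintype V] [DecidableEq V]

/-- Volume of a vertex set: the sum of the degrees of its vertices. -/
def vol (G : SimpleGraph V) [DecidableRel G.Adj] (S : Finset V) : ℕ :=
  ∑ v ∈ S, G.degree v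

/-- Number of edges between two (disjoint) vertex sets. -/
def cut (G : SimpleGraph V) [DecidableRel G.Adj] (S T : Finset V) : ℕ :=
  ∑ u ∈ S, (T.filter fun v => G.Adj u v).card

/-- Conductance `φ(S) = |E(S, V \ S)| / μ(S)`. -/
noncomputable def conductance (G : SimpleGraph V) [DecidableRel G.Adj] (S : Finset V) : ℝ :=
  (cut G S Sᶜ : ℝ) / (vol G S : ℝ)

/-- A `k`-way partition of the vertex set into nonempty blocks. -/
def IsKWayPartition {k : ℕ} (P : Fin k → Finset V) : Prop :=
  (∀ i, (P i).Nonempty) ∧ (∀ i j, i ≠ j → Disjoint (P i) (P j)) ∧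
    (∀ v : V, ∃ i, v ∈ P i)

/-- Maximum conductance over the blocks of a tuple of sets. -/
noncomputable def maxCond (G : SimpleGraph V) [DecidableRel G.Adj] {k : ℕ}
    (P : Fin k → Finset V) : ℝ :=
  ⨆ i, conductance G (P i)

/-- Average conductance of the blocks. -/
noncomputable def avgCond (G : SimpleGraph V) [DecidableRel G.Adj] {k : ℕ}
    (P : Fin k → Finset V) : ℝ :=
  (∑ i, conductance G (P i)) / (k : ℝ)

/-- `P` achieves `ρ̂_avr(k)`: it minimizes the maximum conductance among all
`k`-way partitions, and among those it has minimal average conductance. -/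
def AchievesRhoAvr (G : SimpleGraph V) [DecidableRel G.Adj] {k : ℕ}
    (P : Fin k → Finset V) : Prop :=
  IsKWayPartition P ∧
  (∀ Q : Fin k → Finset V, IsKWayPartition Q → maxCond G P ≤ maxCond G Q) ∧
  (∀ Q : Fin k → Finset V, IsKWayPartition Q → maxCond G Q = maxCond G P →
    avgCond G P ≤ avgCond G Q)

/-- Dot product of two vectors indexed by the vertices. -/
def dotV (x y : V → ℝ) : ℝ := ∑ v, x v * y v

/-- The normalized Laplacian `I - D^{-1/2} A D^{-1/2}`. -/
noncomputable def normLap (G : SimpleGraph V) [DecidableRel G.Adj] : Matrix V V ℝ :=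
  1 - Matrix.diagonal (fun v => (Real.sqrt (G.degree v))⁻¹) * G.adjMatrix ℝ *
      Matrix.diagonal (fun v => (Real.sqrt (G.degree v))⁻¹)

/-- `f` is an orthonormal family of eigenvectors of the normalized Laplacian of `G`
with (sorted) eigenvalues `lam`. -/
structure EigenData (G : SimpleGraph V) [DecidableRel G.Adj]
    (f : Fin (Fintype.card V) → V → ℝ) (lam : Fin (Fintype.card V) → ℝ) : Prop where
  eig : ∀ i, (normLap G).mulVec (f i) = lam i • f i
  ortho : ∀ i j, dotV (f i) (f j) = if i = j then (1 : ℝ) else 0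
  mono : Monotone lam

/-- The gap parameter `Ψ = λ_{k+1} / ρ̂_avr(k)`, where `ρ̂_avr(k)` is realized as the
average conductance of the fixed optimal partition `P`. -/
noncomputable def Psi (G : SimpleGraph V) [DecidableRel G.Adj]
    (lam : Fin (Fintype.card V) → ℝ) {k : ℕ} (P : Fin k → Finset V)
    (hkn : k < Fintype.card V) : ℝ :=
  lam ⟨k, hkn⟩ / avgCond G P

/-- The spectral embedding `F(u) = d_u^{-1/2} (f_1(u), …, f_k(u))`. -/
noncomputable def Femb (G : SimpleGraph V) [DecidableRel G.Adj]
    (f : Fin (Fintype.card V) → V → ℝ) {k : ℕ} (hk : k ≤ Fintype.card V) (u : V) :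
    Fin k → ℝ :=
  fun j => f (Fin.castLE hk j) u / Real.sqrt (G.degree u)

/-- `k`-means cost of a clustering of the (degree-weighted) spectral embedding:
`∑_i ∑_{u ∈ A_i} d_u ‖F(u) - c_i‖²`. -/
noncomputable def kmCost (G : SimpleGraph V) [DecidableRel G.Adj]
    (f : Fin (Fintype.card V) → V → ℝ) {k : ℕ} (hk : k ≤ Fintype.card V) {ℓ : ℕ}
    (A : Fin ℓ → Finset V) (c : Fin ℓ → Fin k → ℝ) : ℝ :=
  ∑ i, ∑ u ∈ A i, (G.degree u : ℝ) * ∑ j, (Femb G f hk u j - c i j) ^ 2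

/-- `Δ_ℓ(𝒳_V)`: the optimal `ℓ`-means cost of the spectral embedding multiset `𝒳_V`
(which contains `d_u` copies of `F(u)` for every vertex `u`). -/
noncomputable def kmOpt (G : SimpleGraph V) [DecidableRel G.Adj]
    (f : Fin (Fintype.card V) → V → ℝ) {k : ℕ} (hk : k ≤ Fintype.card V) (ℓ : ℕ) : ℝ :=
  sInf { r : ℝ | ∃ (A : Fin ℓ → Finset V) (c : Fin ℓ → Fin k → ℝ),
    (∀ i j, i ≠ j → Disjoint (A i) (A j)) ∧ (∀ v : V, ∃ i, v ∈ A i) ∧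
    r = kmCost G f hk A c }

/-- Normalized characteristic vector `ḡ_i = D^{1/2} χ_{P_i} / √μ(P_i)`. -/
noncomputable def gbar (G : SimpleGraph V) [DecidableRel G.Adj] {k : ℕ}
    (P : Fin k → Finset V) (i : Fin k) : V → ℝ :=
  fun v => (if v ∈ P i then Real.sqrt (G.degree v) else 0) / Real.sqrt (vol G (P i))

/-- Coefficients `α_j^{(i)} = ⟨ḡ_i, f_j⟩` of `ḡ_i` in the eigenbasis. -/
noncomputable def alpha (G : SimpleGraph V) [DecidableRel G.Adj] {k : ℕ}
    (P : Fin k → Finset V) (f : Fin (Fintype.card V) → V → ℝ)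
    (i : Fin k) (j : Fin (Fintype.card V)) : ℝ :=
  dotV (gbar G P i) (f j)

/-- Projection `f̂_i = ∑_{j=1}^k α_j^{(i)} f_j` of `ḡ_i` onto the first `k` eigenvectors. -/
noncomputable def fhat (G : SimpleGraph V) [DecidableRel G.Adj] {k : ℕ}
    (P : Fin k → Finset V) (f : Fin (Fintype.card V) → V → ℝ) (i : Fin k) : V → ℝ :=
  fun v => ∑ j : Fin (Fintype.card V),
    if (j : ℕ) < k then alpha G P f i j * f j v else 0

/-- Estimation center `p^{(i)} = μ(P_i)^{-1/2} (β_i^{(1)}, …, β_i^{(k)})`;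
here `beta i j` denotes `β_j^{(i)}`. -/
noncomputable def estCenter (G : SimpleGraph V) [DecidableRel G.Adj] {k : ℕ}
    (P : Fin k → Finset V) (beta : Fin k → Fin k → ℝ) (i : Fin k) : Fin k → ℝ :=
  fun j => beta j i / Real.sqrt (vol G (P i))

theorem dotV_comm {W : Type} [Fintype W] (x y : W → ℝ) : dotV x y = dotV y x :=
  dotProduct_comm x y

theorem normLap_isSymm (G : SimpleGraph V) [DecidableRel G.Adj] : (normLap G).IsSymm := by
  simp [Matrix.IsSymm, normLap, Matrix.transpose_mul, Matrix.mul_assoc]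

theorem dotV_normLap_mulVec_comm (G : SimpleGraph V) [DecidableRel G.Adj] (x y : V → ℝ) :
    dotV ((normLap G).mulVec x) y = dotV x ((normLap G).mulVec y) := by
  change (normLap G).mulVec x ⬝ᵥ y = x ⬝ᵥ (normLap G).mulVec y
  rw [Matrix.dotProduct_mulVec, ← Matrix.mulVec_transpose, (normLap_isSymm G).eq]

/-- The quadratic form of the normalized Laplacian as a sum over adjacent pairs. -/
theorem dotV_normLap_mulVec_self (G : SimpleGraph V) [DecidableRel G.Adj]
    (hd : ∀ v : V, 0 < G.degree v) (x : V → ℝ) :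
    dotV x ((normLap G).mulVec x) =
      (∑ u, ∑ v, if G.Adj u v then
        (x u / Real.sqrt (G.degree u) - x v / Real.sqrt (G.degree v)) ^ 2 else 0) / 2 := by
  set y : V → ℝ := fun v => x v / Real.sqrt (G.degree v) with hy
  have hdeg (u : V) : ∑ v, (if G.Adj u v then y u ^ 2 else 0) = x u ^ 2 := by
    have h0 : (0 : ℝ) < G.degree u := by exact_mod_cast hd u
    rw [← Finset.sum_filter, Finset.sum_const, ← G.neighborFinset_eq_filter,
      G.card_neighborFinset_eq_degree, nsmul_eq_mul, hy]
    simp only [div_pow, Real.sq_sqrt h0.le]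
    field_simp
  have hleft : dotV x ((normLap G).mulVec x) =
      ∑ u, x u ^ 2 - ∑ u, ∑ v, if G.Adj u v then y u * y v else 0 := by
    rw [dotV, ← Finset.sum_sub_distrib]
    refine Finset.sum_congr rfl fun u _ => ?_
    rw [normLap, Matrix.sub_mulVec, Matrix.one_mulVec, Pi.sub_apply, mul_sub, ← sq,
      Matrix.mulVec, dotProduct, Finset.mul_sum]
    congr 1
    refine Finset.sum_congr rfl fun v _ => ?_
    rw [Matrix.mul_diagonal, Matrix.diagonal_mul, SimpleGraph.adjMatrix_apply]
    split_ifs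
    · simp only [hy, div_eq_mul_inv]
      ring
    · simp
  have hswap : ∑ u, ∑ v, (if G.Adj u v then y v ^ 2 else 0) = ∑ u, x u ^ 2 := by
    rw [Finset.sum_comm]
    simp only [G.adj_comm, hdeg]
  have hexp : (∑ u, ∑ v, if G.Adj u v then (y u - y v) ^ 2 else 0) =
      ∑ u, ∑ v, (if G.Adj u v then y u ^ 2 else 0) +
        ∑ u, ∑ v, (if G.Adj u v then y v ^ 2 else 0) -
        2 * ∑ u, ∑ v, if G.Adj u v then y u * y v else 0 := by
    simp only [Finset.mul_sum, ← Finset.sum_add_distrib, ← Finset.sum_sub_distrib]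
    refine Finset.sum_congr rfl fun u _ => Finset.sum_congr rfl fun v _ => ?_
    split_ifs <;> ring
  rw [hleft, hexp, hswap]
  simp only [hdeg]
  ring

/-- Parseval's identity for an orthonormal family of full cardinality. -/
theorem dotV_eq_sum_of_orthonormal {f : Fin (Fintype.card V) → V → ℝ}
    (ho : ∀ i j, dotV (f i) (f j) = if i = j then (1 : ℝ) else 0) (x y : V → ℝ) :
    dotV x y = ∑ j, dotV x (f j) * dotV y (f j) := by
  have h1 : Matrix.of f * (Matrix.of f)ᵀ = 1 := by
    ext i j
    simpa [Matrix.mul_apply, Matrix.one_apply, dotV] using ho i j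
  have h2 : (Matrix.of f)ᵀ * Matrix.of f = 1 :=
    (Matrix.mul_eq_one_comm_of_card_eq _ _ _ (by simp)).mp h1
  calc dotV x y = x ⬝ᵥ ((Matrix.of f)ᵀ * Matrix.of f).mulVec y := by
        rw [h2, Matrix.one_mulVec]; rfl
    _ = (Matrix.of f).mulVec x ⬝ᵥ (Matrix.of f).mulVec y := by
        rw [← Matrix.mulVec_mulVec, Matrix.dotProduct_mulVec, Matrix.vecMul_transpose]
    _ = ∑ j, dotV x (f j) * dotV y (f j) :=
        Finset.sum_congr rfl fun j _ => by
          rw [dotV_comm x, dotV_comm y]; rfl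

theorem EigenData.lam_nonneg {G : SimpleGraph V} [DecidableRel G.Adj]
    {f : Fin (Fintype.card V) → V → ℝ} {lam : Fin (Fintype.card V) → ℝ}
    (hf : EigenData G f lam) (hd : ∀ v : V, 0 < G.degree v) (j : Fin (Fintype.card V)) :
    0 ≤ lam j := by
  have h : dotV (f j) ((normLap G).mulVec (f j)) = lam j := by
    rw [hf.eig]
    change f j ⬝ᵥ (lam j • f j) = lam j
    rw [dotProduct_smul, show f j ⬝ᵥ f j = 1 from (hf.ortho j j).trans (if_pos rfl), smul_eq_mul, mul_one]
  rw [← h, dotV_normLap_mulVec_self G hd]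
  refine div_nonneg (Finset.sum_nonneg fun u _ => Finset.sum_nonneg fun v _ => ?_) two_pos.le
  split_ifs <;> positivity

/-- The quadratic form of the normalized Laplacian in an eigenbasis. -/
theorem EigenData.dotV_normLap_mulVec_self {G : SimpleGraph V} [DecidableRel G.Adj]
    {f : Fin (Fintype.card V) → V → ℝ} {lam : Fin (Fintype.card V) → ℝ}
    (hf : EigenData G f lam) (x : V → ℝ) :
    dotV x ((normLap G).mulVec x) = ∑ j, lam j * dotV x (f j) ^ 2 := by
  rw [dotV_eq_sum_of_orthonormal hf.ortho]
  refine Finset.sum_congr rfl fun j _ => ?_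
  rw [dotV_normLap_mulVec_comm, hf.eig,
    show dotV x (lam j • f j) = lam j * dotV x (f j) from dotProduct_smul _ _ _]
  ring

section Partition

variable {G : SimpleGraph V} [DecidableRel G.Adj] {k : ℕ} {P : Fin k → Finset V}

theorem vol_pos {W : Type} [Fintype W] {G : SimpleGraph W} [DecidableRel G.Adj]
    (hd : ∀ v : W, 0 < G.degree v) {S : Finset W} (hS : S.Nonempty) :
    (0 : ℝ) < vol G S := by
  exact_mod_cast Finset.sum_pos (fun v _ => hd v) hS

theorem conductance_nonneg (S : Finset V) : 0 ≤ conductance G S := by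
  unfold conductance
  positivity

theorem dotV_gbar_self (hd : ∀ v : V, 0 < G.degree v) {i : Fin k} (hi : (P i).Nonempty) :
    dotV (gbar G P i) (gbar G P i) = 1 := by
  have hv := vol_pos hd hi
  have h (v : V) : gbar G P i v * gbar G P i v =
      (if v ∈ P i then (G.degree v : ℝ) else 0) / vol G (P i) := by
    rw [gbar, div_mul_div_comm, Real.mul_self_sqrt hv.le]
    split_ifs
    · rw [Real.mul_self_sqrt (Nat.cast_nonneg _)]
    · simp
  simp only [dotV, h]
  rw [← Finset.sum_div, div_eq_one_iff_eq hv.ne']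
  simp [vol]

theorem dotV_gbar_of_disjoint {p q : Fin k} (h : Disjoint (P p) (P q)) :
    dotV (gbar G P p) (gbar G P q) = 0 := by
  refine Finset.sum_eq_zero fun v _ => ?_
  by_cases hp : v ∈ P p
  · simp [gbar, Finset.disjoint_left.mp h hp]
  · simp [gbar, hp]

/-- The Rayleigh quotient of a normalized characteristic vector is the conductance. -/
theorem dotV_gbar_normLap (hd : ∀ v : V, 0 < G.degree v) (i : Fin k) :
    dotV (gbar G P i) ((normLap G).mulVec (gbar G P i)) = conductance G (P i) := by
  rw [dotV_normLap_mulVec_self G hd]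
  have hg (v : V) : gbar G P i v / Real.sqrt (G.degree v) =
      (if v ∈ P i then 1 else 0) / Real.sqrt (vol G (P i)) := by
    have h0 : Real.sqrt (G.degree v) ≠ 0 := (Real.sqrt_pos.mpr (by exact_mod_cast hd v)).ne'
    rw [gbar, div_right_comm]
    split_ifs <;> simp [h0]
  have hcut : (cut G (P i) (P i)ᶜ : ℝ) =
      ∑ u, ∑ v, if u ∈ P i ∧ v ∉ P i ∧ G.Adj u v then (1 : ℝ) else 0 := by
    have h (u : V) : (∑ v, if u ∈ P i ∧ v ∉ P i ∧ G.Adj u v then (1 : ℝ) else 0) =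
        if u ∈ P i then (((P i)ᶜ.filter fun v => G.Adj u v).card : ℝ) else 0 := by
      split_ifs with hu
      · simp only [hu, true_and, Finset.sum_boole]
        congr 2
        ext v
        simp
      · simp [hu]
    simp only [h, cut, Nat.cast_sum, Finset.sum_ite_mem, Finset.univ_inter]
  have hcut' : (cut G (P i) (P i)ᶜ : ℝ) =
      ∑ u, ∑ v, if v ∈ P i ∧ u ∉ P i ∧ G.Adj u v then (1 : ℝ) else 0 := by
    rw [hcut, Finset.sum_comm]
    simp only [G.adj_comm]
  have hsum : (∑ u, ∑ v, if G.Adj u v then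
        (gbar G P i u / Real.sqrt (G.degree u) - gbar G P i v / Real.sqrt (G.degree v)) ^ 2
        else 0) = (cut G (P i) (P i)ᶜ + cut G (P i) (P i)ᶜ : ℝ) / vol G (P i) := by
    nth_rewrite 1 [hcut]
    rw [hcut']
    simp only [← Finset.sum_add_distrib, Finset.sum_div]
    refine Finset.sum_congr rfl fun u _ => Finset.sum_congr rfl fun v _ => ?_
    rw [hg, hg, ← sub_div, div_pow, Real.sq_sqrt (Nat.cast_nonneg _)]
    by_cases hu : u ∈ P i <;> by_cases hv : v ∈ P i <;> by_cases ha : G.Adj u v <;>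
      simp [hu, hv, ha]
  rw [hsum, conductance]
  ring

variable {f : Fin (Fintype.card V) → V → ℝ} {lam : Fin (Fintype.card V) → ℝ}

theorem dotV_fhat (ho : ∀ i j, dotV (f i) (f j) = if i = j then (1 : ℝ) else 0)
    (p q : Fin k) :
    dotV (fhat G P f p) (fhat G P f q) =
      ∑ j : Fin (Fintype.card V), if (j : ℕ) < k then alpha G P f p j * alpha G P f q j else 0 := by
  have hc (i : Fin k) (j : Fin (Fintype.card V)) :
      dotV (fhat G P f i) (f j) = if (j : ℕ) < k then alpha G P f i j else 0 := by
    have h : dotV (fhat G P f i) (f j) = ∑ l : Fin (Fintype.card V),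
        (if (l : ℕ) < k then alpha G P f i l else 0) * dotV (f l) (f j) := by
      simp only [dotV, fhat, Finset.sum_mul, Finset.mul_sum]
      rw [Finset.sum_comm]
      refine Finset.sum_congr rfl fun l _ => Finset.sum_congr rfl fun v _ => ?_
      split_ifs <;> ring
    rw [h]
    simp [ho]
  rw [dotV_eq_sum_of_orthonormal ho]
  refine Finset.sum_congr rfl fun j _ => ?_
  rw [hc, hc]
  split_ifs <;> simp

/-- The head and the tail of the eigenbasis expansion add up to the inner product. -/
theorem dotV_fhat_add_tail (ho : ∀ i j, dotV (f i) (f j) = if i = j then (1 : ℝ) else 0)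
    (p q : Fin k) :
    dotV (fhat G P f p) (fhat G P f q) +
        ∑ j with ¬ (j : Fin (Fintype.card V)).val < k, alpha G P f p j * alpha G P f q j =
      dotV (gbar G P p) (gbar G P q) := by
  rw [dotV_fhat ho, dotV_eq_sum_of_orthonormal ho (gbar G P p), ← Finset.sum_filter]
  exact Finset.sum_filter_add_sum_filter_not _ _ _

/-- The mass of a normalized characteristic vector outside the first `k` eigenvectors is at
most the conductance divided by the next eigenvalue. -/
theorem tail_sq_le (hd : ∀ v : V, 0 < G.degree v) (hkn : k < Fintype.card V)
    (hf : EigenData G f lam) (hlam : 0 < lam ⟨k, hkn⟩) (i : Fin k) :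
    ∑ j with ¬ (j : Fin (Fintype.card V)).val < k, alpha G P f i j ^ 2 ≤
      conductance G (P i) / lam ⟨k, hkn⟩ := by
  rw [le_div_iff₀ hlam, ← dotV_gbar_normLap hd, hf.dotV_normLap_mulVec_self, Finset.sum_mul]
  calc _ ≤ ∑ j with ¬ (j : Fin (Fintype.card V)).val < k, lam j * alpha G P f i j ^ 2 := by
        refine Finset.sum_le_sum fun j hj => ?_
        rw [mul_comm]
        refine mul_le_mul_of_nonneg_right (hf.mono ?_) (sq_nonneg _)
        exact not_lt.mp (Finset.mem_filter.mp hj).2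
    _ ≤ _ := Finset.sum_le_sum_of_subset_of_nonneg (Finset.filter_subset _ _)
        fun j _ _ => mul_nonneg (hf.lam_nonneg hd j) (sq_nonneg _)

end Partition

theorem fhat_norms_and_inner_products
    {V : Type} [Fintype V] [DecidableEq V] (G : SimpleGraph V) [DecidableRel G.Adj]
    (hd : ∀ v : V, 0 < G.degree v)
    {k : ℕ} (hkn : k < Fintype.card V)
    (f : Fin (Fintype.card V) → V → ℝ) (lam : Fin (Fintype.card V) → ℝ)
    (hf : EigenData G f lam)
    (P : Fin k → Finset V) (hP : IsKWayPartition P)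
    (hlam : 0 < lam ⟨k, hkn⟩) :
    (∀ i : Fin k,
        1 - conductance G (P i) / lam ⟨k, hkn⟩ ≤ dotV (fhat G P f i) (fhat G P f i) ∧
          dotV (fhat G P f i) (fhat G P f i) =
            (∑ j : Fin (Fintype.card V),
              if (j : ℕ) < k then (alpha G P f i j) ^ 2 else 0) ∧
          dotV (fhat G P f i) (fhat G P f i) ≤ 1) ∧
      ∀ p q : Fin k, p ≠ q →
        |dotV (fhat G P f p) (fhat G P f q)| ≤
          Real.sqrt (conductance G (P p) * conductance G (P q)) / lam ⟨k, hkn⟩ := by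
  refine ⟨fun i => ?_, fun p q hpq => ?_⟩
  · have hsplit := dotV_fhat_add_tail (G := G) (P := P) hf.ortho i i
    rw [dotV_gbar_self hd (hP.1 i)] at hsplit
    simp only [← sq] at hsplit
    have htail := tail_sq_le (P := P) hd hkn hf hlam i
    have h0 : 0 ≤ ∑ j with ¬ (j : Fin (Fintype.card V)).val < k, alpha G P f i j ^ 2 :=
      Finset.sum_nonneg fun j _ => sq_nonneg _
    refine ⟨by linarith, ?_, by linarith⟩
    simp only [dotV_fhat hf.ortho, ← sq]
  · have hsplit := dotV_fhat_add_tail (G := G) (P := P) hf.ortho p q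
    rw [dotV_gbar_of_disjoint (hP.2.1 p q hpq)] at hsplit
    rw [eq_neg_of_add_eq_zero_left hsplit, abs_neg]
    refine abs_le_of_sq_le_sq ?_ (div_nonneg (Real.sqrt_nonneg _) hlam.le)
    rw [div_pow, Real.sq_sqrt (mul_nonneg (conductance_nonneg _) (conductance_nonneg _)), sq (lam _),
      ← div_mul_div_comm]
    exact (Finset.sum_mul_sq_le_sq_mul_sq _ _ _).trans <|
      mul_le_mul (tail_sq_le hd hkn hf hlam p) (tail_sq_le hd hkn hf hlam q)
        (Finset.sum_nonneg fun j _ => sq_nonneg _)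
        (div_nonneg (conductance_nonneg _) hlam.le)

end SpectralClustering
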